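/- arXiv:1506.06967 — 7 statements merged into one kernel-verified Lean document; each statement's English description precedes it below -/
import Mathlib

section
/- Let I be the additive monoid ℕ. Let A = ℕ with the I-action α = (α_l, α_r) where α_l(n)(k) = k + n and α_r(n) is the identity for all n, and let B = ℕ with the I-action β = (β_l, β_r) where β_l(n) is the identity and β_r(n)(k) = k ∸ n (truncated subtraction) for all n. Then α and β are indeed I-actions, the identity function from A to B is I-equivariant, but the identity function from B to A is not I-equivariant. -/
/-- An action of a monoid `I` on a set `A`: a commuting pair of a left action and
a right action, both unital. -/
structure BiAction (I : Type*) [Monoid I] (A : Type*) where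
  l : I → A → A
  r : I → A → A
  l_mul : ∀ i j a, l (i * j) a = l i (l j a)
  r_mul : ∀ i j a, r (i * j) a = r j (r i a)
  l_one : ∀ a, l 1 a = a
  r_one : ∀ a, r 1 a = a
  comm : ∀ i j a, r j (l i a) = l i (r j a)

/-- `f : A → B` is `I`-equivariant. -/
def IsEquivariant {I A B : Type*} [Monoid I] (α : BiAction I A) (β : BiAction I B)
    (f : A → B) : Prop :=
  ∀ i a, β.r i (f (α.l i a)) = β.l i (f (α.r i a))

/-- over the additive monoid `ℕ` (written multiplicatively via
`Multiplicative ℕ`), the pair `α = (k ↦ k + n, id)` and the pair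
`β = (id, k ↦ k ∸ n)` are actions of `ℕ` on `ℕ`, the identity `A → B` is
equivariant, but the identity `B → A` is not. -/
theorem identity_equivariant_one_way_only :
    ∃ α β : BiAction (Multiplicative ℕ) ℕ,
      (∀ n k, α.l n k = k + Multiplicative.toAdd n) ∧
      (∀ n k, α.r n k = k) ∧
      (∀ n k, β.l n k = k) ∧
      (∀ n k, β.r n k = k - Multiplicative.toAdd n) ∧
      IsEquivariant α β id ∧ ¬ IsEquivariant β α id := by
  refine ⟨
    { l := fun n k => k + n.toAdd
      r := fun _ k => k
      l_mul := fun i j a => by simp only [toAdd_mul]; omega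
      r_mul := fun _ _ _ => rfl
      l_one := fun _ => rfl
      r_one := fun _ => rfl
      comm := fun _ _ _ => rfl },
    { l := fun _ k => k
      r := fun n k => k - n.toAdd
      l_mul := fun _ _ _ => rfl
      r_mul := fun i j a => by simp only [toAdd_mul]; omega
      l_one := fun _ => rfl
      r_one := fun _ => rfl
      comm := fun _ _ _ => rfl },
    fun _ _ => rfl, fun _ _ => rfl, fun _ _ => rfl, fun _ _ => rfl,
    fun i a => Nat.add_sub_cancel (n := a) (m := i.toAdd), fun h => ?_⟩
  exact absurd (h (Multiplicative.ofAdd 1) 0) (by simp)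
end

section
/- Let I be a monoid and let (A, α) be an I-set. Then the evaluation function ev_l : lMap(lMap(A)) → lMap(A), ev_l(h) = h(1), is an I-equivariant bijection, whose inverse is the function Φ : lMap(A) → lMap(lMap(A)) given by Φ(g)(i)(j) = g(i ⊗ j); in particular Φ is well defined (Φ(g) indeed lies in lMap(lMap(A)) for every g ∈ lMap(A)). -/
/-- `f : I → A` is equivariant when `I` carries the action `(ι_l, μ_r)`. -/
def lEquivariant {I A : Type*} [Monoid I] (α : BiAction I A) (f : I → A) : Prop :=
  ∀ i j, α.r i (f j) = α.l i (f (j * i))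

/-- `lMap(A)`, the set of equivariant functions `I → A` (right action on `I` trivial). -/
def lMapT {I A : Type*} [Monoid I] (α : BiAction I A) : Type _ :=
  {f : I → A // lEquivariant α f}

/-- The inverse-from-left-to-right action `θ` on `lMap(A)`:
`θ_l(k) = id` and `θ_r(k)(f) = (j ↦ f(k ⊗ j))`. -/
def theta {I A : Type*} [Monoid I] (α : BiAction I A) : BiAction I (lMapT α) where
  l _ f := f
  r k f := ⟨fun j => f.val (k * j), by intro i j; rw [f.prop i (k * j), mul_assoc]⟩
  l_mul := by intros; rfl
  r_mul := by intro i j f; apply Subtype.ext; funext x; simp only [mul_assoc]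
  l_one := by intros; rfl
  r_one := by intro f; apply Subtype.ext; funext x; simp only [one_mul]
  comm := by intros; rfl


/-- the evaluation `ev_l : lMap(lMap(A)) → lMap(A)`, `h ↦ h(1)`, is an
`I`-equivariant bijection whose inverse is `Φ : lMap(A) → lMap(lMap(A))` given by
`Φ(g)(i)(j) = g(i ⊗ j)` (in particular such a well-defined `Φ` exists). -/
theorem evl_lMap_lMap_equiv {I A : Type*} [Monoid I] (α : BiAction I A) :
    IsEquivariant (theta (theta α)) (theta α)
        (fun h : lMapT (theta α) => h.val 1) ∧
      ∃ Φ : lMapT α → lMapT (theta α),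
        (∀ (g : lMapT α) (i j : I), ((Φ g).val i).val j = g.val (i * j)) ∧
        Function.LeftInverse Φ (fun h : lMapT (theta α) => h.val 1) ∧
        Function.RightInverse Φ (fun h : lMapT (theta α) => h.val 1) := by
  refine ⟨fun i h => (h.prop i 1).trans (congrArg h.val ((one_mul i).trans (mul_one i).symm)),
    fun g => ⟨fun i => (theta α).r i g, fun i j => ((theta α).r_mul j i g).symm⟩,
    fun _ _ _ => rfl, fun h => Subtype.ext ?_, (theta α).r_one⟩
  funext i
  exact (h.prop i 1).trans (congrArg h.val (one_mul i))
end

section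
/- Let I be a monoid and let (A, α) be an I-set. Then the evaluation function ev_r : rMap(rMap(A)) → rMap(A), ev_r(h) = h(1), is an I-equivariant bijection, whose inverse is the function Ψ : rMap(A) → rMap(rMap(A)) given by Ψ(g)(i)(j) = g(j ⊗ i); in particular Ψ is well defined (Ψ(g) indeed lies in rMap(rMap(A)) for every g ∈ rMap(A)). -/
/-- `f : I → A` is equivariant when `I` carries the action `(μ_l, ι_r)`. -/
def rEquivariant {I A : Type*} [Monoid I] (α : BiAction I A) (f : I → A) : Prop :=
  ∀ i j, α.r i (f (i * j)) = α.l i (f j)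

/-- `rMap(A)`, the set of equivariant functions `I → A` (left action on `I` trivial). -/
def rMapT {I A : Type*} [Monoid I] (α : BiAction I A) : Type _ :=
  {f : I → A // rEquivariant α f}

/-- The inverse-from-right-to-left action `ϑ` on `rMap(A)`:
`ϑ_l(k)(f) = (i ↦ f(i ⊗ k))` and `ϑ_r(k) = id`. -/
def vartheta {I A : Type*} [Monoid I] (α : BiAction I A) : BiAction I (rMapT α) where
  l k f := ⟨fun i => f.val (i * k), by intro i j; show α.r i (f.val (i * j * k)) = α.l i (f.val (j * k)); rw [mul_assoc]; exact f.prop i (j * k)⟩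
  r _ f := f
  l_mul := by intro i j f; apply Subtype.ext; funext x; simp only [mul_assoc]
  r_mul := by intros; rfl
  l_one := by intro f; apply Subtype.ext; funext x; simp only [mul_one]
  r_one := by intros; rfl
  comm := by intros; rfl


/-- the evaluation `ev_r : rMap(rMap(A)) → rMap(A)`, `h ↦ h(1)`, is an
`I`-equivariant bijection whose inverse is `Ψ : rMap(A) → rMap(rMap(A))` given by
`Ψ(g)(i)(j) = g(j ⊗ i)` (in particular such a well-defined `Ψ` exists). -/
theorem evr_rMap_rMap_equiv {I A : Type*} [Monoid I] (α : BiAction I A) :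
    IsEquivariant (vartheta (vartheta α)) (vartheta α)
        (fun h : rMapT (vartheta α) => h.val 1) ∧
      ∃ Ψ : rMapT α → rMapT (vartheta α),
        (∀ (g : rMapT α) (i j : I), ((Ψ g).val i).val j = g.val (j * i)) ∧
        Function.LeftInverse Ψ (fun h : rMapT (vartheta α) => h.val 1) ∧
        Function.RightInverse Ψ (fun h : rMapT (vartheta α) => h.val 1) := by
  refine ⟨fun i h => ?_, fun g => ⟨fun i => (vartheta α).l i g, fun i j => ?_⟩,
    fun _ _ _ => rfl, fun h => ?_, fun g => (vartheta α).l_one g⟩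
  · have hi : h.val (i * 1) = (vartheta α).l i (h.val 1) := h.prop i 1
    change h.val (1 * i) = (vartheta α).l i (h.val 1)
    rw [one_mul, ← hi, mul_one]
  · exact (vartheta α).l_mul i j g
  · apply Subtype.ext
    funext i
    have hi : h.val (i * 1) = (vartheta α).l i (h.val 1) := h.prop i 1
    change (vartheta α).l i (h.val 1) = h.val i
    rw [← hi, mul_one]
end

section
/- Let I be a monoid and let (M, α) be an I-set. Then the evaluation function ev : InvE(M) → M defined by ev(f) = f(1)(1) is I-equivariant, where InvE(M) = lMap(rMap(M)) carries its I-action θ and M carries the action α. -/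
/-- the evaluation `ev : InvE(M) → M`, `f ↦ f(1)(1)`, is
`I`-equivariant, where `InvE(M) = lMap(rMap(M))` carries the action `θ`. -/
theorem ev_InvE_isEquivariant {I M : Type*} [Monoid I] (α : BiAction I M) :
    IsEquivariant (theta (vartheta α)) α
      (fun f : lMapT (vartheta α) => (f.val 1).val 1) := by
  intro i f
  have h : (f.val 1).val 1 = (f.val (1 * i)).val (1 * i) :=
    congrArg (fun g : rMapT α => g.val 1) (f.prop i 1)
  have h' := (f.val i).prop i 1
  change α.r i ((f.val 1).val 1) = α.l i ((f.val (i * 1)).val 1)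
  rw [h, one_mul, mul_one, ← h', mul_one]
end

section
/- Let I be a commutative monoid and let (X, α) be an I-set. Then the evaluation function ev : InvE(InvE(X)) → InvE(X), ev(g) = g(1)(1), is an I-equivariant bijection, whose inverse is the function Φ_X : InvE(X) → InvE(InvE(X)) given by Φ_X(g)(i)(j)(k)(l) = g(i ⊗ k)(j ⊗ l). -/
/-- Elements of `lMap(rMap(A))` are invariant under simultaneous translation of both arguments. -/
theorem lMapT.val_val_mul_mul {I A : Type*} [Monoid I] {α : BiAction I A}
    (f : lMapT (vartheta α)) (a j m : I) :
    (f.val (j * a)).val (m * a) = (f.val j).val m :=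
  (congrArg (fun h : rMapT α => h.val m) (f.prop a j)).symm

/-- Elements of `rMap(lMap(A))` are invariant under simultaneous translation of both arguments. -/
theorem rMapT.val_mul_mul {I A : Type*} [Monoid I] {α : BiAction I A}
    (f : rMapT (theta α)) (a j k : I) :
    (f.val (a * j)).val (a * k) = (f.val j).val k :=
  congrArg (fun h : lMapT α => h.val k) (f.prop a j)

theorem lMapT.ev_val_mul {I X : Type*} [CommMonoid I] {α : BiAction I X}
    (g : lMapT (vartheta (theta (vartheta α)))) (i k : I) :
    ((g.val 1).val 1).val (i * k) = ((g.val i).val 1).val k := by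
  rw [← g.val_val_mul_mul i 1 1, one_mul, ← rMapT.val_mul_mul (g.val i) i 1 k, mul_one]

/-- The inverse `Φ_X` of the evaluation map. -/
def lMapT.invEDiag {I X : Type*} [CommMonoid I] {α : BiAction I X}
    (g : lMapT (vartheta α)) : lMapT (vartheta (theta (vartheta α))) :=
  ⟨fun i => ⟨fun j => ⟨fun k => ⟨fun l => (g.val (i * k)).val (j * l), by
          intro a l
          change α.r a ((g.val (i * k)).val (j * (a * l))) = α.l a ((g.val (i * k)).val (j * l))
          rw [mul_left_comm]
          exact (g.val (i * k)).prop a (j * l)⟩, by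
        intro a k
        apply Subtype.ext
        funext l
        change (g.val (i * k)).val (j * l) = (g.val (i * (k * a))).val (j * (l * a))
        rw [← mul_assoc, ← mul_assoc, g.val_val_mul_mul]⟩, by
      intro a j
      apply Subtype.ext
      funext k
      apply Subtype.ext
      funext l
      change (g.val (i * (a * k))).val (a * j * l) = (g.val (i * k)).val (j * l)
      rw [mul_left_comm, mul_assoc, mul_comm a, mul_comm a, g.val_val_mul_mul]⟩, by
    intro a i
    apply Subtype.ext
    funext j
    apply Subtype.ext
    funext k
    apply Subtype.ext
    funext l
    change (g.val (i * k)).val (j * l) = (g.val (i * a * k)).val (j * a * l)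
    rw [mul_right_comm, mul_right_comm j, g.val_val_mul_mul]⟩

/-- for a commutative monoid `I` and an `I`-set `X`, the evaluation
`ev : InvE(InvE(X)) → InvE(X)`, `g ↦ g(1)(1)`, is an `I`-equivariant bijection
whose inverse is `Φ_X : InvE(X) → InvE(InvE(X))` given by
`Φ_X(g)(i)(j)(k)(l) = g(i ⊗ k)(j ⊗ l)`, where `InvE(A) = lMap(rMap(A))`. -/
theorem ev_InvE_InvE_equiv {I X : Type*} [CommMonoid I] (α : BiAction I X) :
    IsEquivariant (theta (vartheta (theta (vartheta α)))) (theta (vartheta α))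
        (fun g : lMapT (vartheta (theta (vartheta α))) => (g.val 1).val 1) ∧
      ∃ Φ : lMapT (vartheta α) → lMapT (vartheta (theta (vartheta α))),
        (∀ (g : lMapT (vartheta α)) (i j k l : I),
          (((((Φ g).val i).val j).val k).val l : X) = (g.val (i * k)).val (j * l)) ∧
        Function.LeftInverse Φ
          (fun g : lMapT (vartheta (theta (vartheta α))) => (g.val 1).val 1) ∧
        Function.RightInverse Φ
          (fun g : lMapT (vartheta (theta (vartheta α))) => (g.val 1).val 1) := by
  refine ⟨fun i g => ?_, lMapT.invEDiag, fun _ _ _ _ _ => rfl, fun g => ?_, fun g => ?_⟩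
  · apply Subtype.ext
    funext k
    change ((g.val 1).val 1).val (i * k) = ((g.val (i * 1)).val 1).val k
    rw [mul_one, g.ev_val_mul]
  · apply Subtype.ext
    funext i
    apply Subtype.ext
    funext j
    apply Subtype.ext
    funext k
    apply Subtype.ext
    funext l
    change (((g.val 1).val 1).val (i * k)).val (j * l) = (((g.val i).val j).val k).val l
    rw [g.ev_val_mul, ← rMapT.val_mul_mul (g.val i) j 1 k, mul_one, mul_comm j k, mul_comm j l,
      lMapT.val_val_mul_mul]
  · apply Subtype.ext
    funext k
    apply Subtype.ext
    funext l
    change (g.val (1 * k)).val (1 * l) = (g.val k).val l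
    rw [one_mul, one_mul]
end

section
/- Let I be a monoid, let A be a finite set, and let (A, α) be an I-set whose right component is trivial (α_r(i) = id for all i ∈ I). For x ∈ A let Ix = {α_l(i)(x) : i ∈ I} denote the orbit of x, and let A^l = {x ∈ A : for all i ∈ I, the restriction of α_l(i) to Ix is injective}. Then the map f ↦ f(1) is a bijection from lMap(A) onto A^l. -/
namespace BiAction

variable {I A : Type*} [Monoid I] (α : BiAction I A)

/-- The orbit of `x` under the left component of an action. -/
def lOrbit (x : A) : Set A := {y : A | ∃ j : I, y = α.l j x}

lemma mem_lOrbit_self (x : A) : x ∈ α.lOrbit x := ⟨1, (α.l_one x).symm⟩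

lemma mapsTo_lOrbit (i : I) (x : A) : Set.MapsTo (α.l i) (α.lOrbit x) (α.lOrbit x) := by
  rintro _ ⟨j, rfl⟩
  exact ⟨i * j, (α.l_mul i j x).symm⟩

lemma exists_mem_lOrbit_l_eq [Finite A] {x : A} {i : I}
    (h : Set.InjOn (α.l i) (α.lOrbit x)) : ∃ y ∈ α.lOrbit x, α.l i y = x :=
  (((Set.toFinite _).injOn_iff_bijOn_of_mapsTo (α.mapsTo_lOrbit i x)).1 h).surjOn
    (α.mem_lOrbit_self x)

end BiAction

namespace lEquivariant

variable {I A : Type*} [Monoid I] {α : BiAction I A} {f : I → A}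

lemma l_apply_mul (hf : lEquivariant α f) (hr : ∀ i a, α.r i a = a) (i j : I) :
    α.l i (f (j * i)) = f j := by
  rw [← hf i j, hr]

lemma l_apply_self (hf : lEquivariant α f) (hr : ∀ i a, α.r i a = a) (i : I) :
    α.l i (f i) = f 1 := by
  simpa using hf.l_apply_mul hr i 1

variable [Finite A]

/-- Each `α.l i` permutes the range of an equivariant function. -/
lemma bijOn_range (hf : lEquivariant α f) (hr : ∀ i a, α.r i a = a) (i : I) :
    Set.BijOn (α.l i) (Set.range f) (Set.range f) := by
  have hsub : Set.range f ⊆ α.l i '' Set.range f := by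
    rintro _ ⟨j, rfl⟩
    exact ⟨_, ⟨j * i, rfl⟩, hf.l_apply_mul hr i j⟩
  have himage : Set.range f = α.l i '' Set.range f :=
    Set.eq_of_subset_of_ncard_le hsub (Set.ncard_image_le (Set.toFinite _))
  have hmaps : Set.MapsTo (α.l i) (Set.range f) (Set.range f) :=
    Set.mapsTo_iff_image_subset.2 himage.ge
  exact ((Set.toFinite _).surjOn_iff_bijOn_of_mapsTo hmaps).1 hsub

lemma lOrbit_subset_range (hf : lEquivariant α f) (hr : ∀ i a, α.r i a = a) :
    α.lOrbit (f 1) ⊆ Set.range f := by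
  rintro _ ⟨j, rfl⟩
  exact (hf.bijOn_range hr j).mapsTo ⟨1, rfl⟩

lemma injOn_lOrbit (hf : lEquivariant α f) (hr : ∀ i a, α.r i a = a) (i : I) :
    Set.InjOn (α.l i) (α.lOrbit (f 1)) :=
  (hf.bijOn_range hr i).injOn.mono (hf.lOrbit_subset_range hr)

lemma apply_mem_lOrbit (hf : lEquivariant α f) (hr : ∀ i a, α.r i a = a) (i : I) :
    f i ∈ α.lOrbit (f 1) := by
  obtain ⟨y, hy, hiy⟩ := α.exists_mem_lOrbit_l_eq (hf.injOn_lOrbit hr i)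
  have : f i = y := (hf.bijOn_range hr i).injOn ⟨i, rfl⟩ (hf.lOrbit_subset_range hr hy)
    ((hf.l_apply_self hr i).trans hiy.symm)
  exact this ▸ hy

/-- An equivariant function is determined by its value at `1`. -/
lemma eq_of_apply_one_eq {g : I → A} (hf : lEquivariant α f) (hg : lEquivariant α g)
    (hr : ∀ i a, α.r i a = a) (h : f 1 = g 1) : f = g := by
  funext i
  refine hf.injOn_lOrbit hr i (hf.apply_mem_lOrbit hr i) (h ▸ hg.apply_mem_lOrbit hr i) ?_
  rw [hf.l_apply_self hr, hg.l_apply_self hr, h]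

end lEquivariant

/-- If every `α.l i` is injective on the orbit of `x`, then `x` is the value at `1` of some
equivariant function. -/
lemma BiAction.exists_lEquivariant_apply_one_eq {I A : Type*} [Monoid I] [Finite A]
    (α : BiAction I A) (hr : ∀ i a, α.r i a = a) {x : A}
    (hx : ∀ i, Set.InjOn (α.l i) (α.lOrbit x)) : ∃ f, lEquivariant α f ∧ f 1 = x := by
  choose f hmem hf using fun i => α.exists_mem_lOrbit_l_eq (hx i)
  refine ⟨f, fun i j => ?_, by rw [← α.l_one (f 1), hf]⟩
  rw [hr]
  refine hx j (hmem j) (α.mapsTo_lOrbit i x (hmem (j * i))) ?_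
  rw [hf, ← α.l_mul, hf]

/-- for a monoid `I` and a finite `I`-set `A` with trivial right
component, evaluation at `1` is a bijection from `lMap(A)` onto
`A^l = {x : α_l(i) is injective on the orbit `Ix` for every i}`. -/
theorem lMap_equiv_Al {I A : Type*} [Monoid I] [Finite A]
    (α : BiAction I A) (hr : ∀ i a, α.r i a = a) :
    ∃ e : lMapT α ≃
        {x : A // ∀ i : I, Set.InjOn (α.l i) {y : A | ∃ j : I, y = α.l j x}},
      ∀ f : lMapT α, (e f : A) = f.val 1 := by
  refine ⟨Equiv.ofBijective (fun f => ⟨f.val 1, f.prop.injOn_lOrbit hr⟩) ⟨?_, ?_⟩, fun _ => rfl⟩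
  · intro f g h
    exact Subtype.ext (f.prop.eq_of_apply_one_eq g.prop hr (congrArg Subtype.val h))
  · rintro ⟨x, hx⟩
    obtain ⟨f, hf, h⟩ := α.exists_lEquivariant_apply_one_eq hr hx
    exact ⟨⟨f, hf⟩, Subtype.ext h⟩
end

section
/- Let I be a monoid, let A be a finite set, and let (A, α) be an I-set whose left component is trivial (α_l(i) = id for all i ∈ I). For x ∈ A let xI = {α_r(i)(x) : i ∈ I} denote the orbit of x, and let A^r = {x ∈ A : for all i ∈ I, the restriction of α_r(i) to xI is injective}. Then the map f ↦ f(1) is a bijection from rMap(A) onto A^r. -/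
/-- The orbit `xI` of `x` under the right component of the action. -/
def BiAction.rOrbit {I A : Type*} [Monoid I] (α : BiAction I A) (x : A) : Set A :=
  {y : A | ∃ j : I, y = α.r j x}

theorem BiAction.self_mem_rOrbit {I A : Type*} [Monoid I] (α : BiAction I A) (x : A) :
    x ∈ α.rOrbit x :=
  ⟨1, (α.r_one x).symm⟩

theorem BiAction.mapsTo_rOrbit {I A : Type*} [Monoid I] (α : BiAction I A) (x : A) (i : I) :
    Set.MapsTo (α.r i) (α.rOrbit x) (α.rOrbit x) := by
  rintro _ ⟨j, rfl⟩
  exact ⟨j * i, (α.r_mul j i x).symm⟩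

theorem Set.SurjOn.image_eq_and_injOn {A : Type*} [Finite A] {s : Set A} {g : A → A}
    (h : Set.SurjOn g s s) : g '' s = s ∧ Set.InjOn g s := by
  have hs : s = g '' s :=
    Set.eq_of_subset_of_ncard_le h (Set.ncard_image_le s.toFinite) (Set.toFinite _)
  exact ⟨hs.symm, Set.injOn_of_ncard_image_eq (congrArg Set.ncard hs.symm) s.toFinite⟩

theorem Set.InjOn.surjOn_self {A : Type*} [Finite A] {s : Set A} {g : A → A}
    (h : Set.InjOn g s) (hm : Set.MapsTo g s s) : Set.SurjOn g s s :=
  (Set.eq_of_subset_of_ncard_le hm.image_subset h.ncard_image.ge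
    s.toFinite).ge

section Equivariant

variable {I A : Type*} [Monoid I] {α : BiAction I A} {f : I → A}

theorem rEquivariant.r_apply_mul (hf : rEquivariant α f) (hl : ∀ i a, α.l i a = a) (i j : I) :
    α.r i (f (i * j)) = f j :=
  (hf i j).trans (hl i (f j))

theorem rEquivariant.r_apply (hf : rEquivariant α f) (hl : ∀ i a, α.l i a = a) (i : I) :
    α.r i (f i) = f 1 := by
  simpa using hf.r_apply_mul hl i 1

theorem rEquivariant.surjOn_range (hf : rEquivariant α f) (hl : ∀ i a, α.l i a = a) (i : I) :
    Set.SurjOn (α.r i) (Set.range f) (Set.range f) := by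
  rintro _ ⟨j, rfl⟩
  exact ⟨f (i * j), ⟨i * j, rfl⟩, hf.r_apply_mul hl i j⟩

variable [Finite A]

theorem rEquivariant.rOrbit_subset_range (hf : rEquivariant α f) (hl : ∀ i a, α.l i a = a) :
    α.rOrbit (f 1) ⊆ Set.range f := by
  rintro _ ⟨j, rfl⟩
  rw [← (hf.surjOn_range hl j).image_eq_and_injOn.1]
  exact ⟨f 1, ⟨1, rfl⟩, rfl⟩

theorem rEquivariant.injOn_rOrbit (hf : rEquivariant α f) (hl : ∀ i a, α.l i a = a) (i : I) :
    Set.InjOn (α.r i) (α.rOrbit (f 1)) :=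
  (hf.surjOn_range hl i).image_eq_and_injOn.2.mono (hf.rOrbit_subset_range hl)

theorem rEquivariant.apply_mem_rOrbit (hf : rEquivariant α f) (hl : ∀ i a, α.l i a = a) (i : I) :
    f i ∈ α.rOrbit (f 1) := by
  obtain ⟨y, hy, hyi⟩ := (hf.injOn_rOrbit hl i).surjOn_self (α.mapsTo_rOrbit _ i)
    (α.self_mem_rOrbit (f 1))
  have h : y = f i := (hf.surjOn_range hl i).image_eq_and_injOn.2
    (hf.rOrbit_subset_range hl hy) ⟨i, rfl⟩ (hyi.trans (hf.r_apply hl i).symm)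
  exact h ▸ hy

theorem exists_rEquivariant_of_injOn_rOrbit (hl : ∀ i a, α.l i a = a) {x : A}
    (hx : ∀ i, Set.InjOn (α.r i) (α.rOrbit x)) : ∃ f : I → A, rEquivariant α f ∧ f 1 = x := by
  choose f hf hfx using fun i =>
    (hx i).surjOn_self (α.mapsTo_rOrbit x i) (α.self_mem_rOrbit x)
  refine ⟨f, fun i j => ?_, by simpa [α.r_one] using hfx 1⟩
  rw [hl]
  refine hx j (α.mapsTo_rOrbit x i (hf (i * j))) (hf j) ?_
  rw [← α.r_mul, hfx, hfx]

end Equivariant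

/-- for a monoid `I` and a finite `I`-set `A` with trivial left
component, evaluation at `1` is a bijection from `rMap(A)` onto
`A^r = {x : α_r(i) is injective on the orbit `xI` for every i}`. -/
theorem rMap_equiv_Ar {I A : Type*} [Monoid I] [Finite A]
    (α : BiAction I A) (hl : ∀ i a, α.l i a = a) :
    ∃ e : rMapT α ≃
        {x : A // ∀ i : I, Set.InjOn (α.r i) {y : A | ∃ j : I, y = α.r j x}},
      ∀ f : rMapT α, (e f : A) = f.val 1 := by
  refine ⟨Equiv.ofBijective (fun f => ⟨f.val 1, f.prop.injOn_rOrbit hl⟩) ⟨?_, ?_⟩, fun _ => rfl⟩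
  · intro f g hfg
    have h : f.val 1 = g.val 1 := congrArg Subtype.val hfg
    refine Subtype.ext (funext fun i => f.prop.injOn_rOrbit hl i (f.prop.apply_mem_rOrbit hl i)
      (h ▸ g.prop.apply_mem_rOrbit hl i) ?_)
    rw [f.prop.r_apply hl, g.prop.r_apply hl, h]
  · rintro ⟨x, hx⟩
    obtain ⟨f, hf, hfx⟩ := exists_rEquivariant_of_injOn_rOrbit hl hx
    exact ⟨⟨f, hf⟩, Subtype.ext hfx⟩
end
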